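/- arXiv:2401.10729 — 6 statements merged into one kernel-verified Lean document; each statement's English description precedes it below -/
import Mathlib

section
/- Let G be the series composition of multigraphs G1 and G2 at a vertex x, let a ∈ V1 \ {x} and b ∈ V2 \ {x}, and let r_a, r_b ∈ ℤ with r_a + r_b = 0. Then mincost(G, [a ↦ r_a, b ↦ r_b]) = mincost(G1, [a ↦ r_a, x ↦ −r_a]) + mincost(G2, [x ↦ r_a, b ↦ r_b]), where the addition is in ℕ∞. -/
open scoped BigOperators

/-- An undirected multigraph on vertex type `V` with edge type `E`:
each edge has a reference orientation `src e → tgt e`, a cost `c e` and a capacity `u e`. -/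
structure Multigraph (V E : Type) where
  src : E → V
  tgt : E → V
  c : E → ℕ
  u : E → ℕ

variable {V E : Type}

/-- The residue of a flow assignment `f : E → ℤ` at a vertex `v`:
inflow (w.r.t. the reference orientation) minus outflow. -/
def Multigraph.residue [Fintype E] [DecidableEq V] (G : Multigraph V E)
    (f : E → ℤ) (v : V) : ℤ :=
  (∑ e : E, if G.tgt e = v then f e else 0) - (∑ e : E, if G.src e = v then f e else 0)

/-- `f` is an `r`-circulation supported on `F`: it vanishes outside `F`,
respects capacities, and has residue `r v` at every vertex `v`. -/
def Multigraph.IsCirculation [Fintype E] [DecidableEq V] (G : Multigraph V E)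
    (r : V → ℤ) (F : Finset E) (f : E → ℤ) : Prop :=
  (∀ e, e ∉ F → f e = 0) ∧ (∀ e, |f e| ≤ (G.u e : ℤ)) ∧ (∀ v, G.residue f v = r v)

/-- The minimum cost (in `ℕ∞`) of a subset `F` of the allowed edge set `E'`
admitting an `r`-circulation supported on `F`.  Taking `E' = Finset.univ`
gives `mincost(G, r)`; taking `E' = E₁` for a sub-multigraph `(V₁, E₁)` all of
whose edges have both endpoints in `V₁` gives `mincost(G₁, r)` whenever `r`
vanishes outside `V₁`. -/
noncomputable def Multigraph.mincostOn [Fintype E] [DecidableEq V] (G : Multigraph V E)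
    (E' : Finset E) (r : V → ℤ) : ℕ∞ :=
  ⨅ (F : Finset E) (_ : F ⊆ E' ∧ ∃ f : E → ℤ, G.IsCirculation r F f),
    ((∑ e ∈ F, G.c e : ℕ) : ℕ∞)

namespace Multigraph

section

variable [Fintype E] [DecidableEq V] (G : Multigraph V E)

lemma residue_add (f g : E → ℤ) (v : V) :
    G.residue (f + g) v = G.residue f v + G.residue g v := by
  have h (p : E → Prop) [DecidablePred p] :
      (∑ e : E, if p e then (f + g) e else 0) =
        (∑ e : E, if p e then f e else 0) + ∑ e : E, if p e then g e else 0 := by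
    rw [← Finset.sum_add_distrib]
    refine Finset.sum_congr rfl fun e _ => ?_
    split_ifs <;> simp
  simp only [residue, h]
  ring

lemma residue_eq_zero_of_notMem {W : Finset V} {f : E → ℤ}
    (hf : ∀ e, f e ≠ 0 → G.src e ∈ W ∧ G.tgt e ∈ W) {v : V} (hv : v ∉ W) :
    G.residue f v = 0 := by
  have h (p : E → V) (hp : ∀ e, f e ≠ 0 → p e ∈ W) :
      (∑ e : E, if p e = v then f e else 0) = 0 := by
    refine Finset.sum_eq_zero fun e _ => ?_
    split_ifs with hpe
    · by_contra hfe
      exact hv (hpe ▸ hp e hfe)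
    · rfl
  rw [residue, h _ fun e he => (hf e he).2, h _ fun e he => (hf e he).1, sub_zero]

lemma sum_residue [Fintype V] (f : E → ℤ) : ∑ v, G.residue f v = 0 := by
  simp only [residue, Finset.sum_sub_distrib]
  rw [Finset.sum_comm, Finset.sum_comm (f := fun v e => if G.src e = v then f e else 0)]
  simp

/-- As residues sum to zero, they may be checked at all vertices but one. -/
lemma residue_eq_of_forall_ne [Fintype V] {f : E → ℤ} {r : V → ℤ} (x : V)
    (hr : ∑ v, r v = 0) (h : ∀ v, v ≠ x → G.residue f v = r v) (v : V) :
    G.residue f v = r v := by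
  by_cases hv : v = x
  · subst hv
    have hs : ∑ w, (G.residue f w - r w) = 0 := by
      rw [Finset.sum_sub_distrib, G.sum_residue, hr, sub_zero]
    rw [Finset.sum_eq_single v (fun w _ hw => sub_eq_zero.2 (h w hw)) (by simp)] at hs
    exact sub_eq_zero.1 hs
  · exact h v hv

lemma mincostOn_le {E' F : Finset E} {r : V → ℤ} {f : E → ℤ} (hF : F ⊆ E')
    (hf : G.IsCirculation r F f) : G.mincostOn E' r ≤ ((∑ e ∈ F, G.c e : ℕ) : ℕ∞) :=
  iInf₂_le F ⟨hF, f, hf⟩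

lemma IsCirculation.add [DecidableEq E] {G : Multigraph V E} {r₁ r₂ : V → ℤ}
    {F₁ F₂ : Finset E} {f₁ f₂ : E → ℤ} (hF : Disjoint F₁ F₂)
    (h₁ : G.IsCirculation r₁ F₁ f₁) (h₂ : G.IsCirculation r₂ F₂ f₂) :
    G.IsCirculation (r₁ + r₂) (F₁ ∪ F₂) (f₁ + f₂) := by
  refine ⟨fun e he => ?_, fun e => ?_, fun v => ?_⟩
  · rw [Finset.notMem_union] at he
    simp [h₁.1 e he.1, h₂.1 e he.2]
  · by_cases he : e ∈ F₁
    · simpa [h₂.1 e (Finset.disjoint_left.1 hF he)] using h₁.2.1 e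
    · simpa [h₁.1 e he] using h₂.2.1 e
  · rw [residue_add, h₁.2.2, h₂.2.2, Pi.add_apply]

lemma mincostOn_union_le [DecidableEq E] {E₁ E₂ : Finset E} (hE : Disjoint E₁ E₂)
    (r₁ r₂ : V → ℤ) :
    G.mincostOn (E₁ ∪ E₂) (r₁ + r₂) ≤ G.mincostOn E₁ r₁ + G.mincostOn E₂ r₂ := by
  conv_rhs => simp only [mincostOn]
  simp only [ENat.iInf_add, ENat.add_iInf]
  refine le_iInf₂ fun F₂ h₂ => le_iInf₂ fun F₁ h₁ => ?_
  obtain ⟨hF₁, f₁, hf₁⟩ := h₁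
  obtain ⟨hF₂, f₂, hf₂⟩ := h₂
  have hF : Disjoint F₁ F₂ := hE.mono hF₁ hF₂
  rw [← Nat.cast_add, ← Finset.sum_union hF]
  exact G.mincostOn_le (Finset.union_subset_union hF₁ hF₂) (hf₁.add hF hf₂)

/-- One side of a circulation on a series composition, with the balance of that side
restored at the cut vertex `x`. -/
lemma IsCirculation.restrict [Fintype V] [DecidableEq E] {G : Multigraph V E}
    {V₁ V₂ : Finset V} {E₁ E₂ : Finset E} (hE : E₁ ∪ E₂ = Finset.univ)
    (hG₁ : ∀ e ∈ E₁, G.src e ∈ V₁ ∧ G.tgt e ∈ V₁)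
    (hG₂ : ∀ e ∈ E₂, G.src e ∈ V₂ ∧ G.tgt e ∈ V₂)
    {x : V} (hx : V₁ ∩ V₂ = {x}) {r₁ r₂ : V → ℤ} (hr₁ : ∀ v ∉ V₁, r₁ v = 0)
    (hr₂ : ∀ v ∉ V₂, r₂ v = 0) (hs : ∑ v, r₁ v = 0)
    {F : Finset E} {f : E → ℤ} (hf : G.IsCirculation (r₁ + r₂) F f) :
    G.IsCirculation r₁ (F ∩ E₁) (fun e => if e ∈ E₁ then f e else 0) := by
  refine ⟨fun e he => ?_, fun e => ?_, G.residue_eq_of_forall_ne x hs fun v hv => ?_⟩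
  · dsimp only
    split_ifs with h
    · exact hf.1 e fun hF => he (Finset.mem_inter.2 ⟨hF, h⟩)
    · rfl
  · dsimp only
    split_ifs
    · exact hf.2.1 e
    · simp
  · by_cases hv₁ : v ∈ V₁
    · have hv₂ : v ∉ V₂ := fun hv₂ =>
        hv (Finset.mem_singleton.1 (hx ▸ Finset.mem_inter.2 ⟨hv₁, hv₂⟩))
      have hsplit : f = (fun e => if e ∈ E₁ then f e else 0) +
          fun e => if e ∈ E₁ then 0 else f e := by
        ext e
        by_cases he : e ∈ E₁ <;> simp [he]
      have hres := hf.2.2 v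
      rw [hsplit, residue_add, Pi.add_apply, hr₂ v hv₂,
        G.residue_eq_zero_of_notMem (f := fun e => if e ∈ E₁ then 0 else f e) ?_ hv₂] at hres
      · simpa using hres
      · intro e he
        have hmem : e ∈ E₁ ∪ E₂ := hE ▸ Finset.mem_univ e
        refine hG₂ e ((Finset.mem_union.1 hmem).resolve_left fun h => he ?_)
        simp [h]
    · rw [hr₁ v hv₁]
      refine G.residue_eq_zero_of_notMem (fun e he => hG₁ e ?_) hv₁
      by_contra h
      simp [h] at he

theorem mincostOn_univ_add [Fintype V] [DecidableEq E] {V₁ V₂ : Finset V}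
    {E₁ E₂ : Finset E} (hE : E₁ ∪ E₂ = Finset.univ) (hEdisj : Disjoint E₁ E₂)
    (hG₁ : ∀ e ∈ E₁, G.src e ∈ V₁ ∧ G.tgt e ∈ V₁)
    (hG₂ : ∀ e ∈ E₂, G.src e ∈ V₂ ∧ G.tgt e ∈ V₂)
    {x : V} (hx : V₁ ∩ V₂ = {x}) {r₁ r₂ : V → ℤ} (hr₁ : ∀ v ∉ V₁, r₁ v = 0)
    (hr₂ : ∀ v ∉ V₂, r₂ v = 0) (hs₁ : ∑ v, r₁ v = 0) (hs₂ : ∑ v, r₂ v = 0) :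
    G.mincostOn Finset.univ (r₁ + r₂) = G.mincostOn E₁ r₁ + G.mincostOn E₂ r₂ := by
  refine le_antisymm (hE ▸ G.mincostOn_union_le hEdisj r₁ r₂) (le_iInf₂ fun F hF => ?_)
  obtain ⟨-, f, hf⟩ := hF
  have hcost : ∑ e ∈ F, G.c e = ∑ e ∈ F ∩ E₁, G.c e + ∑ e ∈ F ∩ E₂, G.c e := by
    rw [← Finset.sum_union (hEdisj.mono Finset.inter_subset_right Finset.inter_subset_right),
      ← Finset.inter_union_distrib_left, hE, Finset.inter_univ]
  rw [hcost, Nat.cast_add]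
  refine add_le_add
    (G.mincostOn_le Finset.inter_subset_right (hf.restrict hE hG₁ hG₂ hx hr₁ hr₂ hs₁))
    (G.mincostOn_le Finset.inter_subset_right (f := fun e => if e ∈ E₂ then f e else 0) ?_)
  rw [add_comm] at hf
  exact hf.restrict ((Finset.union_comm _ _).trans hE) hG₂ hG₁
    ((Finset.inter_comm _ _).trans hx) hr₂ hr₁ hs₂

end

end Multigraph

/-- Case 1.1: series composition, 2-tuple of residues. -/
theorem series_two_tuple {V E : Type}
    [Fintype V] [Fintype E] [DecidableEq V] [DecidableEq E]
    (G : Multigraph V E) (V1 V2 : Finset V) (E1 E2 : Finset E)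
    (hE : E1 ∪ E2 = Finset.univ) (hEdisj : Disjoint E1 E2)
    (hV : V1 ∪ V2 = Finset.univ)
    (hG1 : ∀ e ∈ E1, G.src e ∈ V1 ∧ G.tgt e ∈ V1)
    (hG2 : ∀ e ∈ E2, G.src e ∈ V2 ∧ G.tgt e ∈ V2)
    (x a b : V) (hVx : V1 ∩ V2 = {x})
    (ha : a ∈ V1) (hax : a ≠ x) (hb : b ∈ V2) (hbx : b ≠ x)
    (ra rb : ℤ) (hsum : ra + rb = 0) :
    G.mincostOn Finset.univ (fun v => if v = a then ra else if v = b then rb else 0) =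
      G.mincostOn E1 (fun v => if v = a then ra else if v = x then -ra else 0) +
      G.mincostOn E2 (fun v => if v = x then ra else if v = b then rb else 0) := by
  have hab : a ≠ b := by
    rintro rfl
    exact hax (Finset.mem_singleton.1 (hVx ▸ Finset.mem_inter.2 ⟨ha, hb⟩))
  obtain ⟨hx1, hx2⟩ : x ∈ V1 ∧ x ∈ V2 :=
    Finset.mem_inter.1 (hVx ▸ Finset.mem_singleton_self x)
  have hsum_pair (p q : V) (hpq : p ≠ q) (s t : ℤ) :
      ∑ v, (if v = p then s else if v = q then t else 0) = s + t := by
    rw [Finset.sum_eq_add p q hpq (fun v _ hv => by simp [hv.1, hv.2]) (by simp) (by simp)]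
    simp [hpq.symm]
  rw [← G.mincostOn_univ_add hE hEdisj hG1 hG2 hVx]
  · congr 1
    ext v
    simp only [Pi.add_apply]
    split_ifs <;> simp_all
  · intro v hv
    simp [ne_of_mem_of_not_mem ha hv |>.symm, ne_of_mem_of_not_mem hx1 hv |>.symm]
  · intro v hv
    simp [ne_of_mem_of_not_mem hx2 hv |>.symm, ne_of_mem_of_not_mem hb hv |>.symm]
  · rw [hsum_pair a x hax, add_neg_cancel]
  · rw [hsum_pair x b hbx.symm, hsum]
end

section
/- Let G be the series composition of multigraphs G1 and G2 at a vertex x, let r : V → ℤ, and let f be an r-circulation on G supported on E. Then the restriction of f to E1 (extended by 0 on E2) is an r1-circulation on G1 supported on E1, where r1 v = r v for every v ∈ V1 \ {x} and r1 x = −(Σ over v ∈ V1 \ {x} of r v). -/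
open scoped BigOperators

variable {V E : Type}

theorem Multigraph.residue_congr [Fintype E] [DecidableEq V] (G : Multigraph V E)
    {f g : E → ℤ} {v : V} (h : ∀ e, G.src e = v ∨ G.tgt e = v → f e = g e) :
    G.residue f v = G.residue g v := by
  unfold Multigraph.residue
  congr 1 <;> refine Finset.sum_congr rfl fun e _ => ?_ <;> split_ifs with hv
  exacts [h e (Or.inr hv), rfl, h e (Or.inl hv), rfl]

theorem Multigraph.residue_zero [Fintype E] [DecidableEq V] (G : Multigraph V E) (v : V) :
    G.residue (fun _ => 0) v = 0 := by
  simp [Multigraph.residue]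

/-- The residues of a flow assignment sum to zero over any vertex set containing both
endpoints of every edge that carries flow. -/
theorem Multigraph.sum_residue_eq_zero [Fintype E] [DecidableEq V] (G : Multigraph V E)
    {f : E → ℤ} {S : Finset V} (h : ∀ e, f e ≠ 0 → G.src e ∈ S ∧ G.tgt e ∈ S) :
    ∑ v ∈ S, G.residue f v = 0 := by
  unfold Multigraph.residue
  rw [Finset.sum_sub_distrib, Finset.sum_comm, sub_eq_zero,
    Finset.sum_comm (s := S)]
  refine Finset.sum_congr rfl fun e _ => ?_
  rw [Finset.sum_ite_eq, Finset.sum_ite_eq]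
  by_cases he : f e = 0
  · simp [he]
  · rw [if_pos (h e he).2, if_pos (h e he).1]

/-- Restricting an `r`-circulation on a series composition to the first component
gives an `r₁`-circulation on `G₁`, where `r₁` agrees with `r` on `V₁ \ {x}` and takes
the balancing value `-(∑ v ∈ V₁ \ {x}, r v)` at the cut vertex `x`. -/
theorem series_restrict_circulation {V E : Type}
    [Fintype V] [Fintype E] [DecidableEq V] [DecidableEq E]
    (G : Multigraph V E) (V1 V2 : Finset V) (E1 E2 : Finset E)
    (hE : E1 ∪ E2 = Finset.univ) (hEdisj : Disjoint E1 E2)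
    (hV : V1 ∪ V2 = Finset.univ)
    (hG1 : ∀ e ∈ E1, G.src e ∈ V1 ∧ G.tgt e ∈ V1)
    (hG2 : ∀ e ∈ E2, G.src e ∈ V2 ∧ G.tgt e ∈ V2)
    (x : V) (hVx : V1 ∩ V2 = {x})
    (r : V → ℤ) (f : E → ℤ) (hf : G.IsCirculation r Finset.univ f) :
    G.IsCirculation
      (fun v => if v = x then -(∑ w ∈ V1 \ {x}, r w) else if v ∈ V1 then r v else 0)
      E1 (fun e => if e ∈ E1 then f e else 0) := by
  obtain ⟨-, hcap, hres⟩ := hf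
  have hmem : ∀ e, e ∉ E1 → e ∈ E2 := fun e he =>
    (Finset.mem_union.1 (hE ▸ Finset.mem_univ e)).resolve_left he
  have hx : x ∈ V1 := (Finset.mem_inter.1 (hVx ▸ Finset.mem_singleton_self x)).1
  have hcut : ∀ v, v ∈ V1 → v ∈ V2 → v = x := fun v h1 h2 =>
    Finset.mem_singleton.1 (hVx ▸ Finset.mem_inter.2 ⟨h1, h2⟩)
  have hinner : ∀ v ∈ V1, v ≠ x →
      G.residue (fun e => if e ∈ E1 then f e else 0) v = r v := by
    intro v hv hvx
    rw [← hres v]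
    refine G.residue_congr fun e hev => if_pos ?_
    by_contra he
    obtain ⟨hs, ht⟩ := hG2 e (hmem e he)
    rcases hev with rfl | rfl
    exacts [hvx (hcut _ hv hs), hvx (hcut _ hv ht)]
  refine ⟨fun e he => if_neg he, fun e => ?_, fun v => ?_⟩
  · dsimp only
    split_ifs
    · exact hcap e
    · simp
  · dsimp only
    split_ifs with hvx hv
    · subst hvx
      have hsum := G.sum_residue_eq_zero (f := fun e => if e ∈ E1 then f e else 0) (S := V1)
        fun e he => hG1 e (by by_contra h; exact he (if_neg h))
      rw [← Finset.sum_sdiff (Finset.singleton_subset_iff.2 hx), Finset.sum_singleton,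
        Finset.sum_congr rfl fun w hw => hinner w (Finset.mem_sdiff.1 hw).1
          (Finset.notMem_singleton.1 (Finset.mem_sdiff.1 hw).2)] at hsum
      linarith
    · exact hinner v hv hvx
    · refine (G.residue_congr fun e hev => if_neg fun he => hv ?_).trans (G.residue_zero v)
      rcases hev with rfl | rfl
      exacts [(hG1 e he).1, (hG1 e he).2]
end

section
/- Let G be the parallel composition of multigraphs G1 and G2 at distinct vertices a and b, let r : V → ℤ, and let f be an r-circulation on G supported on E. Then there exists ρ ∈ ℤ such that the restriction of f to E1 (extended by 0 on E2) is an r1-circulation on G1 supported on E1, where r1 v = r v for every v ∈ V1 \ {a, b}, r1 a = ρ, and r1 b = −ρ − (Σ over v ∈ V1 \ {a, b} of r v). -/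
open scoped BigOperators

variable {V E : Type}

/-- The residues of a flow assignment sum to zero. -/
theorem Multigraph.sum_residue_s11 [Fintype V] [Fintype E] [DecidableEq V] (G : Multigraph V E)
    (f : E → ℤ) : ∑ v, G.residue f v = 0 := by
  unfold Multigraph.residue
  rw [Finset.sum_sub_distrib, Finset.sum_comm, Finset.sum_comm (s := Finset.univ (α := V))]
  simp

/-- Restricting an `r`-circulation on a parallel composition to the first component
gives an `r₁`-circulation on `G₁` for some `ρ ∈ ℤ`, where `r₁` agrees with `r` on
`V₁ \ {a, b}`, takes the value `ρ` at `a`, and the balancing value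
`-ρ - (∑ v ∈ V₁ \ {a, b}, r v)` at `b`. -/
theorem parallel_restrict_circulation {V E : Type}
    [Fintype V] [Fintype E] [DecidableEq V] [DecidableEq E]
    (G : Multigraph V E) (V1 V2 : Finset V) (E1 E2 : Finset E)
    (hE : E1 ∪ E2 = Finset.univ) (hEdisj : Disjoint E1 E2)
    (hV : V1 ∪ V2 = Finset.univ)
    (hG1 : ∀ e ∈ E1, G.src e ∈ V1 ∧ G.tgt e ∈ V1)
    (hG2 : ∀ e ∈ E2, G.src e ∈ V2 ∧ G.tgt e ∈ V2)
    (a b : V) (hab : a ≠ b) (hVab : V1 ∩ V2 = {a, b})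
    (r : V → ℤ) (f : E → ℤ) (hf : G.IsCirculation r Finset.univ f) :
    ∃ ρ : ℤ, G.IsCirculation
      (fun v => if v = a then ρ
        else if v = b then -ρ - (∑ w ∈ V1 \ {a, b}, r w)
        else if v ∈ V1 then r v else 0)
      E1 (fun e => if e ∈ E1 then f e else 0) := by
  obtain ⟨-, hcap, hres⟩ := hf
  set g : E → ℤ := fun e => if e ∈ E1 then f e else 0 with hg
  have mem_inter (v : V) : v ∈ V1 ∧ v ∈ V2 ↔ v = a ∨ v = b := by
    rw [← Finset.mem_inter, hVab, Finset.mem_insert, Finset.mem_singleton]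
  have haV := ((mem_inter a).2 (Or.inl rfl)).1
  have hbV := ((mem_inter b).2 (Or.inr rfl)).1
  have mem_E2 (e : E) (he : e ∉ E1) : e ∈ E2 :=
    (Finset.mem_union.1 (hE ▸ Finset.mem_univ e)).resolve_left he
  have res_inner (v : V) (hv : v ∈ V1) (hva : v ≠ a) (hvb : v ≠ b) : G.residue g v = r v := by
    rw [← hres v]
    refine G.residue_congr fun e he => if_pos ?_
    by_contra h
    have h2 := hG2 e (mem_E2 e h)
    have hv2 : v ∈ V2 := by
      rcases he with rfl | rfl
      exacts [h2.1, h2.2]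
    exact ((mem_inter v).1 ⟨hv, hv2⟩).elim hva hvb
  have res_outer (v : V) (hv : v ∉ V1) : G.residue g v = 0 := by
    have h0 : G.residue (fun _ => 0) v = 0 := by simp [Multigraph.residue]
    rw [← h0]
    refine G.residue_congr fun e he => if_neg fun h => hv ?_
    rcases he with rfl | rfl
    exacts [(hG1 e h).1, (hG1 e h).2]
  have hsum : G.residue g a + G.residue g b + ∑ w ∈ V1 \ {a, b}, r w = 0 := by
    have hsub : ({a, b} : Finset V) ⊆ V1 := hVab ▸ Finset.inter_subset_left
    rw [← G.sum_residue_s11 g, ← Finset.sum_subset (Finset.subset_univ V1) fun v _ => res_outer v,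
      ← Finset.sum_sdiff hsub, Finset.sum_pair hab, add_comm]
    congr 1
    refine Finset.sum_congr rfl fun w hw => ?_
    simp only [Finset.mem_sdiff, Finset.mem_insert, Finset.mem_singleton, not_or] at hw
    exact (res_inner w hw.1 hw.2.1 hw.2.2).symm
  refine ⟨G.residue g a, fun e he => if_neg he, fun e => ?_, fun v => ?_⟩
  · by_cases he : e ∈ E1
    · simpa [hg, he] using hcap e
    · simp [hg, he]
  · dsimp only
    split_ifs with hva hvb hv
    · rw [hva]
    · rw [hvb]
      linarith
    · exact res_inner v hv hva hvb
    · exact res_outer v hv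
end

section
/- Let S be a finite set with |S| ≤ m for a natural number m ≥ 1, let u : S → ℕ, and let ε' and M be positive real numbers. If Σ_{e ∈ S} u e ≥ (1 + ε')·M, then Σ_{e ∈ S} ⌊(m · u e)/(M · ε')⌋ ≥ m/ε', where ⌊·⌋ is the integer floor and the final inequality compares the integer sum, cast to ℝ, with m/ε'. -/
open scoped BigOperators

/-- The capacity-scaling inequality used in the FPTAS for budget-constrained max flow:
if a cut of at most `m` edges with integer capacities `u` has total capacity at least
`(1 + ε') · M`, then the total scaled capacity `∑ ⌊m·u_e/(M·ε')⌋` is at least `m/ε'`. -/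
theorem scaled_capacity_lower_bound {S : Type} [Fintype S]
    (m : ℕ) (hm : 1 ≤ m) (hcard : Fintype.card S ≤ m)
    (u : S → ℕ) (ε' M : ℝ) (hε : 0 < ε') (hM : 0 < M)
    (h : (1 + ε') * M ≤ ∑ e : S, (u e : ℝ)) :
    (m : ℝ) / ε' ≤ ((∑ e : S, ⌊((m : ℝ) * (u e : ℝ)) / (M * ε')⌋ : ℤ) : ℝ) := by
  have hcard' : (Fintype.card S : ℝ) ≤ m := by exact_mod_cast hcard
  push_cast
  calc (m : ℝ) / ε' = m / (M * ε') * ((1 + ε') * M) - m := by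
        field_simp
        ring
    _ ≤ m / (M * ε') * ∑ e : S, (u e : ℝ) - Fintype.card S := by gcongr
    _ = ∑ e : S, ((m : ℝ) * u e / (M * ε') - 1) := by
        simp [Finset.mul_sum, div_mul_eq_mul_div]
    _ ≤ ∑ e : S, (⌊(m : ℝ) * u e / (M * ε')⌋ : ℝ) :=
        Finset.sum_le_sum fun _ _ => (Int.sub_one_lt_floor _).le
end

section
/- Consider the multigraph with vertex set {v1, v2, v3, v4} and four edges: e0 from v1 to v2 with cost 0 and capacity u2; e1 from v2 to v3 with cost c1 and capacity u1; e2 from v2 to v3 with cost c2 and capacity u2; e3 from v3 to v4 with cost 0 and capacity u2, where u1, u2, c1, c2 ∈ ℕ and u1 ≤ u2. For every integer f with 0 < f ≤ u2, the minimum over subsets F of the edge set that admit a v1–v4 flow of value f of the total cost Σ_{e ∈ F} c e equals min(c1, c2) if f ≤ u1, and equals c2 if u1 < f ≤ u2 (equivalently, it equals min{ c_i : f ≤ u_i } for i ∈ {1, 2}). -/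
open scoped BigOperators

variable {V E : Type}

/-- The series-parallel gadget for an edge with two mutually exclusive upgrade options
`(c1, u1)` and `(c2, u2)`: vertices `v1 v2 v3 v4 = 0 1 2 3`, edges
`e0 : v1–v2` (cost 0, capacity u2), `e1 : v2–v3` (cost c1, capacity u1),
`e2 : v2–v3` (cost c2, capacity u2), `e3 : v3–v4` (cost 0, capacity u2). -/
def gadgetTwo (u1 u2 c1 c2 : ℕ) : Multigraph (Fin 4) (Fin 4) where
  src := ![0, 1, 1, 2]
  tgt := ![1, 2, 2, 3]
  c := ![0, c1, c2, 0]
  u := ![u2, u1, u2, u2]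

/-- A set of gadget edges admits a flow of value `f` exactly when it contains both terminal
edges together with a middle edge that can carry `f` on its own. -/
theorem gadgetTwo_exists_isCirculation_iff (u1 u2 c1 c2 : ℕ)
    (f : ℤ) (hf0 : 0 < f) (hfu : f ≤ (u2 : ℤ)) (F : Finset (Fin 4)) :
    (∃ g : Fin 4 → ℤ, (gadgetTwo u1 u2 c1 c2).IsCirculation
        (fun v => if v = 0 then -f else if v = 3 then f else 0) F g) ↔
      0 ∈ F ∧ 3 ∈ F ∧ (2 ∈ F ∨ 1 ∈ F ∧ f ≤ (u1 : ℤ)) := by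
  constructor
  · rintro ⟨g, hF, hcap, hres⟩
    have h0 := hres 0
    have h1 := hres 1
    have h3 := hres 3
    simp [Multigraph.residue, gadgetTwo, Fin.sum_univ_four] at h0 h1 h3
    have hg1 : g 1 ≤ u1 := (abs_le.mp (hcap 1)).2
    have hmem : ∀ e, g e ≠ 0 → e ∈ F := fun e he => by_contra fun h => he (hF e h)
    refine ⟨hmem 0 (by omega), hmem 3 (by omega), ?_⟩
    by_cases h2 : g 2 = 0
    · exact Or.inr ⟨hmem 1 (by omega), by omega⟩
    · exact Or.inl (hmem 2 h2)
  · rintro ⟨h0, h3, h2 | ⟨h1, hfu1⟩⟩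
    · refine ⟨![f, 0, f, f], ?_, ?_, ?_⟩
      · intro e he
        fin_cases e <;> simp_all
      · intro e
        fin_cases e <;> simp [gadgetTwo, abs_of_pos hf0, hfu]
      · intro v
        fin_cases v <;> simp [Multigraph.residue, gadgetTwo, Fin.sum_univ_four]
    · refine ⟨![f, f, 0, f], ?_, ?_, ?_⟩
      · intro e he
        fin_cases e <;> simp_all
      · intro e
        fin_cases e <;> simp [gadgetTwo, abs_of_pos hf0, hfu, hfu1]
      · intro v
        fin_cases v <;> simp [Multigraph.residue, gadgetTwo, Fin.sum_univ_four]

/-- In the two-option upgrade gadget, the minimum cost of an edge set admitting a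
`v1`–`v4` flow of value `f` (with `0 < f ≤ u2`) is `min c1 c2` when `f ≤ u1`,
and `c2` when `u1 < f ≤ u2`. -/
theorem gadgetTwo_mincost (u1 u2 c1 c2 : ℕ) (hu : u1 ≤ u2)
    (f : ℤ) (hf0 : 0 < f) (hfu : f ≤ (u2 : ℤ)) :
    (⨅ (F : Finset (Fin 4)) (_ : ∃ g : Fin 4 → ℤ,
        (gadgetTwo u1 u2 c1 c2).IsCirculation
          (fun v => if v = 0 then -f else if v = 3 then f else 0) F g),
      ((∑ e ∈ F, (gadgetTwo u1 u2 c1 c2).c e : ℕ) : ℕ∞)) =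
      if f ≤ (u1 : ℤ) then ((min c1 c2 : ℕ) : ℕ∞) else ((c2 : ℕ) : ℕ∞) := by
  simp only [gadgetTwo_exists_isCirculation_iff u1 u2 c1 c2 f hf0 hfu]
  have hcost : ∀ {F : Finset (Fin 4)} {e}, e ∈ F →
      (gadgetTwo u1 u2 c1 c2).c e ≤ ∑ e ∈ F, (gadgetTwo u1 u2 c1 c2).c e :=
    fun he => Finset.single_le_sum (fun _ _ => Nat.zero_le _) he
  apply le_antisymm
  · have hle2 : (⨅ (F : Finset (Fin 4)) (_ : 0 ∈ F ∧ 3 ∈ F ∧ (2 ∈ F ∨ 1 ∈ F ∧ f ≤ (u1 : ℤ))),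
        ((∑ e ∈ F, (gadgetTwo u1 u2 c1 c2).c e : ℕ) : ℕ∞)) ≤ (c2 : ℕ∞) :=
      iInf₂_le_of_le {0, 2, 3} (by simp) (by simp [gadgetTwo])
    split_ifs with h
    · rcases min_choice c1 c2 with hmin | hmin <;> rw [hmin]
      · exact iInf₂_le_of_le {0, 1, 3} (by simp [h]) (by simp [gadgetTwo])
      · exact hle2
    · exact hle2
  · refine le_iInf₂ fun F hF => ?_
    obtain ⟨-, -, h2 | ⟨h1, hfu1⟩⟩ := hF
    · split_ifs
      · exact Nat.cast_le.mpr ((min_le_right c1 c2).trans (hcost h2))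
      · exact Nat.cast_le.mpr (hcost h2)
    · rw [if_pos hfu1]
      exact Nat.cast_le.mpr ((min_le_left c1 c2).trans (hcost h1))
end

section
/- Consider the multigraph with vertex set {v1, v2, v3, v4, v5, v6} and seven edges: e0 from v1 to v2 with cost 0 and capacity u3; e1 from v2 to v5 with cost c3 and capacity u3; e2 from v2 to v3 with cost 0 and capacity u2; e3 from v3 to v4 with cost c1 and capacity u1; e4 from v3 to v4 with cost c2 and capacity u2; e5 from v4 to v5 with cost 0 and capacity u2; e6 from v5 to v6 with cost 0 and capacity u3, where u1, u2, u3, c1, c2, c3 ∈ ℕ and u1 ≤ u2 ≤ u3. For every integer f with 0 < f ≤ u3, the minimum over subsets F of the edge set that admit a v1–v6 flow of value f of the total cost Σ_{e ∈ F} c e equals min(c1, c2, c3) if f ≤ u1, equals min(c2, c3) if u1 < f ≤ u2, and equals c3 if u2 < f ≤ u3 (equivalently, it equals min{ c_i : f ≤ u_i } for i ∈ {1, 2, 3}). -/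
open scoped BigOperators

variable {V E : Type}

/-- The series-parallel gadget for an edge with three mutually exclusive upgrade options
`(c1, u1)`, `(c2, u2)` and `(c3, u3)`: vertices `v1 … v6 = 0 … 5`, edges
`e0 : v1–v2` (cost 0, capacity u3), `e1 : v2–v5` (cost c3, capacity u3),
`e2 : v2–v3` (cost 0, capacity u2), `e3 : v3–v4` (cost c1, capacity u1),
`e4 : v3–v4` (cost c2, capacity u2), `e5 : v4–v5` (cost 0, capacity u2),
`e6 : v5–v6` (cost 0, capacity u3). -/
def gadgetThree (u1 u2 u3 c1 c2 c3 : ℕ) : Multigraph (Fin 6) (Fin 7) where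
  src := ![0, 1, 1, 2, 2, 3, 4]
  tgt := ![1, 4, 2, 3, 3, 4, 5]
  c := ![0, c3, 0, c1, c2, 0, 0]
  u := ![u3, u3, u2, u1, u2, u2, u3]

/-- Flow conservation in the gadget: the series edges carry the full value, which splits between
the parallel branches. -/
theorem gadgetThree_residue_iff (u1 u2 u3 c1 c2 c3 : ℕ) (f : ℤ) (g : Fin 7 → ℤ) :
    (∀ v, (gadgetThree u1 u2 u3 c1 c2 c3).residue g v =
      if v = 0 then -f else if v = 5 then f else 0) ↔
    g 0 = f ∧ g 6 = f ∧ g 1 + g 2 = f ∧ g 3 + g 4 = g 2 ∧ g 5 = g 2 := by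
  simp [Fin.forall_fin_succ, Multigraph.residue, gadgetThree, Fin.sum_univ_succ]
  omega

/-- The capacity constraints of the gadget, edge by edge. -/
theorem gadgetThree_capacity_iff (u1 u2 u3 c1 c2 c3 : ℕ) (g : Fin 7 → ℤ) :
    (∀ e, |g e| ≤ ((gadgetThree u1 u2 u3 c1 c2 c3).u e : ℤ)) ↔
    |g 0| ≤ u3 ∧ |g 1| ≤ u3 ∧ |g 2| ≤ u2 ∧ |g 3| ≤ u1 ∧ |g 4| ≤ u2 ∧ |g 5| ≤ u2 ∧ |g 6| ≤ u3 := by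
  simp [Fin.forall_fin_succ, gadgetThree]

/-- If the direct edge can carry `f`, the edges `e0, e1, e6` admit a flow of value `f`. -/
theorem gadgetThree_flow_direct (u1 u2 u3 c1 c2 c3 : ℕ) (f : ℤ) (hf0 : 0 < f) (hf : f ≤ u3) :
    ∃ g, (gadgetThree u1 u2 u3 c1 c2 c3).IsCirculation
      (fun v => if v = 0 then -f else if v = 5 then f else 0) {0, 1, 6} g := by
  refine ⟨![f, f, 0, 0, 0, 0, f], ?_, ?_, ?_⟩
  · simp [Fin.forall_fin_succ]
  · rw [gadgetThree_capacity_iff]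
    simp [abs_of_pos hf0, hf]
  · rw [gadgetThree_residue_iff]
    simp

/-- If `f ≤ u1`, the path through `e3` admits a flow of value `f`. -/
theorem gadgetThree_flow_first (u1 u2 u3 c1 c2 c3 : ℕ) (h12 : u1 ≤ u2) (h23 : u2 ≤ u3)
    (f : ℤ) (hf0 : 0 < f) (hf : f ≤ u1) :
    ∃ g, (gadgetThree u1 u2 u3 c1 c2 c3).IsCirculation
      (fun v => if v = 0 then -f else if v = 5 then f else 0) {0, 2, 3, 5, 6} g := by
  refine ⟨![f, 0, f, f, 0, f, f], ?_, ?_, ?_⟩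
  · simp [Fin.forall_fin_succ]
  · rw [gadgetThree_capacity_iff]
    simp [abs_of_pos hf0]
    omega
  · rw [gadgetThree_residue_iff]
    simp

/-- If `f ≤ u2`, the path through `e4` admits a flow of value `f`. -/
theorem gadgetThree_flow_second (u1 u2 u3 c1 c2 c3 : ℕ) (h23 : u2 ≤ u3)
    (f : ℤ) (hf0 : 0 < f) (hf : f ≤ u2) :
    ∃ g, (gadgetThree u1 u2 u3 c1 c2 c3).IsCirculation
      (fun v => if v = 0 then -f else if v = 5 then f else 0) {0, 2, 4, 5, 6} g := by
  refine ⟨![f, 0, f, 0, f, f, f], ?_, ?_, ?_⟩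
  · simp [Fin.forall_fin_succ]
  · rw [gadgetThree_capacity_iff]
    simp [abs_of_pos hf0]
    omega
  · rw [gadgetThree_residue_iff]
    simp

/-- An edge set admitting a flow of value `f > 0` pays for some option of capacity at
least `f`. -/
theorem gadgetThree_exists_option_le_cost (u1 u2 u3 c1 c2 c3 : ℕ)
    (f : ℤ) (hf0 : 0 < f) (F : Finset (Fin 7)) (g : Fin 7 → ℤ)
    (hg : (gadgetThree u1 u2 u3 c1 c2 c3).IsCirculation
      (fun v => if v = 0 then -f else if v = 5 then f else 0) F g) :
    c3 ≤ ∑ e ∈ F, (gadgetThree u1 u2 u3 c1 c2 c3).c e ∨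
    (f ≤ u2 ∧ c2 ≤ ∑ e ∈ F, (gadgetThree u1 u2 u3 c1 c2 c3).c e) ∨
    (f ≤ u1 ∧ c1 ≤ ∑ e ∈ F, (gadgetThree u1 u2 u3 c1 c2 c3).c e) := by
  obtain ⟨hsupp, hcap, hres⟩ := hg
  rw [gadgetThree_residue_iff] at hres
  rw [gadgetThree_capacity_iff] at hcap
  have cost_le (e : Fin 7) (he : g e ≠ 0) :
      (gadgetThree u1 u2 u3 c1 c2 c3).c e ≤ ∑ e ∈ F, (gadgetThree u1 u2 u3 c1 c2 c3).c e :=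
    Finset.single_le_sum (f := (gadgetThree u1 u2 u3 c1 c2 c3).c) (fun _ _ => Nat.zero_le _)
      (not_imp_comm.mp (hsupp e) he)
  by_cases h1 : g 1 = 0
  · have hfu2 : f ≤ u2 := by
      have := le_abs_self (g 2)
      omega
    by_cases h4 : g 4 = 0
    · have hfu1 : f ≤ u1 := by
        have := le_abs_self (g 3)
        omega
      exact Or.inr (Or.inr ⟨hfu1, cost_le 3 (by omega)⟩)
    · exact Or.inr (Or.inl ⟨hfu2, cost_le 4 h4⟩)
  · exact Or.inl (cost_le 1 h1)

/-- In the three-option upgrade gadget, the minimum cost of an edge set admitting a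
`v1`–`v6` flow of value `f` (with `0 < f ≤ u3`) is `min c1 (min c2 c3)` when `f ≤ u1`,
`min c2 c3` when `u1 < f ≤ u2`, and `c3` when `u2 < f ≤ u3`. -/
theorem gadgetThree_mincost (u1 u2 u3 c1 c2 c3 : ℕ) (h12 : u1 ≤ u2) (h23 : u2 ≤ u3)
    (f : ℤ) (hf0 : 0 < f) (hfu : f ≤ (u3 : ℤ)) :
    (⨅ (F : Finset (Fin 7)) (_ : ∃ g : Fin 7 → ℤ,
        (gadgetThree u1 u2 u3 c1 c2 c3).IsCirculation
          (fun v => if v = 0 then -f else if v = 5 then f else 0) F g),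
      ((∑ e ∈ F, (gadgetThree u1 u2 u3 c1 c2 c3).c e : ℕ) : ℕ∞)) =
      if f ≤ (u1 : ℤ) then ((min c1 (min c2 c3) : ℕ) : ℕ∞)
      else if f ≤ (u2 : ℤ) then ((min c2 c3 : ℕ) : ℕ∞)
      else ((c3 : ℕ) : ℕ∞) := by
  apply le_antisymm
  · have le_cost {F : Finset (Fin 7)} {n : ℕ} (hF : ∃ g : Fin 7 → ℤ,
        (gadgetThree u1 u2 u3 c1 c2 c3).IsCirculation
          (fun v => if v = 0 then -f else if v = 5 then f else 0) F g)
        (hn : ∑ e ∈ F, (gadgetThree u1 u2 u3 c1 c2 c3).c e = n) :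
        (⨅ (F : Finset (Fin 7)) (_ : ∃ g : Fin 7 → ℤ,
          (gadgetThree u1 u2 u3 c1 c2 c3).IsCirculation
            (fun v => if v = 0 then -f else if v = 5 then f else 0) F g),
          ((∑ e ∈ F, (gadgetThree u1 u2 u3 c1 c2 c3).c e : ℕ) : ℕ∞)) ≤ (n : ℕ∞) :=
      iInf₂_le_of_le F hF (Nat.cast_le.mpr hn.le)
    have le_first (h : f ≤ u1) := le_cost (n := c1)
      (gadgetThree_flow_first u1 u2 u3 c1 c2 c3 h12 h23 f hf0 h) (by simp [gadgetThree])
    have le_second (h : f ≤ u2) := le_cost (n := c2)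
      (gadgetThree_flow_second u1 u2 u3 c1 c2 c3 h23 f hf0 h) (by simp [gadgetThree])
    have le_direct := le_cost (n := c3)
      (gadgetThree_flow_direct u1 u2 u3 c1 c2 c3 f hf0 hfu) (by simp [gadgetThree])
    split_ifs with h1 h2
    · rcases min_choice c1 (min c2 c3) with h | h <;> rw [h]
      · exact le_first h1
      · rcases min_choice c2 c3 with h | h <;> rw [h]
        · exact le_second (by omega)
        · exact le_direct
    · rcases min_choice c2 c3 with h | h <;> rw [h]
      · exact le_second h2
      · exact le_direct
    · exact le_direct
  · refine le_iInf₂ fun F ⟨g, hg⟩ => ?_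
    have := gadgetThree_exists_option_le_cost u1 u2 u3 c1 c2 c3 f hf0 F g hg
    split_ifs <;> exact Nat.cast_le.mpr (by omega)
end
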